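/- Let B ∈ ℂ^{M×M} be a Hermitian positive semidefinite matrix, σ² > 0 and κ ∈ (0,1). Then the function ρ ↦ log₂ det(I_M + (ρ/σ²)·B) − log₂ det(I_M + ((1−κ)ρ/σ²)·B) is monotonically nondecreasing on [0,∞). -/

import Mathlib

open scoped ComplexOrder

theorem Matrix.IsHermitian.det_one_add_smul {n 𝕜 : Type*} [Fintype n] [DecidableEq n] [RCLike 𝕜]
    {A : Matrix n n 𝕜} (hA : A.IsHermitian) (t : 𝕜) :
    (1 + t • A).det = ∏ i, (1 + t * (hA.eigenvalues i : 𝕜)) := by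
  have h : 1 + t • A = Unitary.conjStarAlgAut 𝕜 _ hA.eigenvectorUnitary
      (Matrix.diagonal fun i => 1 + t * (hA.eigenvalues i : 𝕜)) := by
    have hd : (Matrix.diagonal fun i => 1 + t * (hA.eigenvalues i : 𝕜)) =
        1 + t • Matrix.diagonal (RCLike.ofReal ∘ hA.eigenvalues) := by
      rw [← Matrix.diagonal_one, ← Matrix.diagonal_smul, Matrix.diagonal_add]
      rfl
    rw [hd, map_add, map_one, map_smul, ← hA.spectral_theorem]
  rw [h, Unitary.conjStarAlgAut_apply, Matrix.det_mul_right_comm, ← Matrix.det_diagonal]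
  simp

theorem Matrix.IsHermitian.re_det_one_add_ofReal_smul {n : Type*} [Fintype n] [DecidableEq n]
    {A : Matrix n n ℂ} (hA : A.IsHermitian) (t : ℝ) :
    (1 + (t : ℂ) • A).det.re = ∏ i, (1 + t * hA.eigenvalues i) := by
  rw [hA.det_one_add_smul, ← Complex.ofReal_re (∏ i, (1 + t * hA.eigenvalues i))]
  push_cast
  rfl

/-- Monotonicity of the per-subcarrier SIC sum rate in the transmit power: for
Hermitian positive semidefinite `B ∈ ℂ^{M×M}`, `σ² > 0` and `κ ∈ (0,1)`, the map
`ρ ↦ log₂ det(I + (ρ/σ²)B) − log₂ det(I + ((1−κ)ρ/σ²)B)` is monotonically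
nondecreasing on `[0,∞)`. -/
theorem stmt_16 (M : ℕ) (B : Matrix (Fin M) (Fin M) ℂ) (hB : B.PosSemidef)
    (σ2 κ : ℝ) (hσ : 0 < σ2) (hκ : κ ∈ Set.Ioo (0:ℝ) 1) :
    MonotoneOn
      (fun ρ : ℝ =>
        Real.logb 2 ((1 + ((ρ / σ2 : ℝ) : ℂ) • B).det.re) -
          Real.logb 2 ((1 + (((1 - κ) * ρ / σ2 : ℝ) : ℂ) • B).det.re))
      (Set.Ici (0:ℝ)) := by
  intro a ha b hb hab
  obtain ⟨hκ0, hκ1⟩ := hκ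
  have hev := hB.eigenvalues_nonneg
  simp only [hB.isHermitian.re_det_one_add_ofReal_smul, mul_div_assoc]
  have ha' : 0 ≤ a / σ2 := div_nonneg ha hσ.le
  have hb' : 0 ≤ b / σ2 := div_nonneg hb hσ.le
  have hab' : a / σ2 ≤ b / σ2 := by gcongr
  have hκ' : 0 ≤ 1 - κ := by linarith
  have pos (t : ℝ) (ht : 0 ≤ t) : 0 < ∏ i, (1 + t * hB.isHermitian.eigenvalues i) :=
    Finset.prod_pos fun i _ => by have := mul_nonneg ht (hev i); linarith
  have pa := pos _ ha'
  have pb := pos _ hb'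
  have pka := pos _ (mul_nonneg hκ' ha')
  have pkb := pos _ (mul_nonneg hκ' hb')
  rw [sub_le_sub_iff, ← Real.logb_mul pa.ne' pkb.ne', ← Real.logb_mul pb.ne' pka.ne']
  refine Real.logb_le_logb_of_le one_lt_two (mul_pos pa pkb) ?_
  rw [← Finset.prod_mul_distrib, ← Finset.prod_mul_distrib]
  refine Finset.prod_le_prod (fun i _ => ?_) fun i _ => ?_
  · have := hev i
    positivity
  · have := mul_nonneg (mul_nonneg hκ0.le (sub_nonneg.2 hab')) (hev i)
    linear_combination this
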